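/- Let d, e ∈ ℕ₀ with d = e, let f̄ ∈ C_{d,e}, let β₀, β₁ ∈ ℝ with β₀ ≠ β₁, and define h ∈ ℝ[X,Y,Z] by h(X,Y,Z) = f̄(X, β₀Y + β₁Z, Y + Z) = h₂(X)Y² + h₁(X)YZ + h₀(X)Z². Then: (i) h ∈ C_{d,e}; (ii) if f̄ generates an extreme ray of C_{d,e}, then h generates an extreme ray of C_{d,e}; (iii) if (x₀,y₀,z₀), (x₁,y₁,z₁) ∈ S with z₀ ≠ 0, z₁ ≠ 0, y₀/z₀ ≠ y₁/z₁, f̄(x₀,y₀,z₀) = f̄(x₁,y₁,z₁) = 0, β₀ = y₀/z₀ and β₁ = y₁/z₁, then h₂(x₀) = h₀(x₁) = 0; (iv) if h can be written as r(X)·(p(X)Y + q(X)Z)² with p and q not both zero and gcd(p,q) = 1, then f̄ = (1/(β₀ − β₁)²)·r(X)·((p(X) − q(X))Y + (−β₁p(X) + β₀q(X))Z)², where p − q and −β₁p + β₀q are not both zero and gcd(p − q, −β₁p + β₀q) = 1. -/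

import Mathlib

noncomputable def toMv (p : Polynomial ℝ) : MvPolynomial (Fin 3) ℝ :=
  Polynomial.aeval (MvPolynomial.X 0) p

def inS (x y z : ℝ) : Prop := x ∈ Set.Icc (0:ℝ) 1 ∧ (y, z) ≠ (0, 0)

noncomputable def quadForm (f₂ f₁ f₀ : Polynomial ℝ) : MvPolynomial (Fin 3) ℝ :=
  toMv f₂ * MvPolynomial.X 1 ^ 2 + toMv f₁ * MvPolynomial.X 1 * MvPolynomial.X 2
    + toMv f₀ * MvPolynomial.X 2 ^ 2

def coneC (d e : ℕ) : Set (MvPolynomial (Fin 3) ℝ) :=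
  {f | (∃ f₂ f₁ f₀ : Polynomial ℝ, f = quadForm f₂ f₁ f₀ ∧
          f₂.natDegree ≤ d ∧ f₁.natDegree ≤ (d + e) / 2 ∧ f₀.natDegree ≤ e) ∧
       ∀ x y z : ℝ, inS x y z → 0 ≤ MvPolynomial.eval ![x, y, z] f}

def genExtremeRay (d e : ℕ) (f : MvPolynomial (Fin 3) ℝ) : Prop :=
  f ≠ 0 ∧ f ∈ coneC d e ∧
    ∀ g h : MvPolynomial (Fin 3) ℝ, g ∈ coneC d e → h ∈ coneC d e → g + h = f →
      (∃ c : ℝ, 0 ≤ c ∧ g = c • f) ∧ ∃ c : ℝ, 0 ≤ c ∧ h = c • f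

open MvPolynomial in
/-- The substitution `Y ↦ a Y + b Z`, `Z ↦ c Y + e Z`. -/
noncomputable def linSubst (a b c e : ℝ) : MvPolynomial (Fin 3) ℝ →ₐ[ℝ] MvPolynomial (Fin 3) ℝ :=
  aeval (![X 0, C a * X 1 + C b * X 2, C c * X 1 + C e * X 2] : Fin 3 → MvPolynomial (Fin 3) ℝ)

@[simp] lemma toMv_add (p q : Polynomial ℝ) : toMv (p + q) = toMv p + toMv q :=
  map_add _ p q

@[simp] lemma toMv_sub (p q : Polynomial ℝ) : toMv (p - q) = toMv p - toMv q :=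
  map_sub _ p q

@[simp] lemma toMv_neg (p : Polynomial ℝ) : toMv (-p) = -toMv p :=
  map_neg _ p

@[simp] lemma toMv_mul (p q : Polynomial ℝ) : toMv (p * q) = toMv p * toMv q :=
  map_mul _ p q

@[simp] lemma toMv_C (a : ℝ) : toMv (Polynomial.C a) = MvPolynomial.C a :=
  Polynomial.aeval_C _ a

lemma eval_toMv (p : Polynomial ℝ) (v : Fin 3 → ℝ) :
    MvPolynomial.eval v (toMv p) = p.eval (v 0) := by
  have h := Polynomial.hom_eval₂ p (algebraMap ℝ (MvPolynomial (Fin 3) ℝ))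
    (MvPolynomial.eval v) (MvPolynomial.X 0)
  rw [MvPolynomial.eval_X, show (MvPolynomial.eval v).comp
    (algebraMap ℝ (MvPolynomial (Fin 3) ℝ)) = RingHom.id ℝ from
      RingHom.ext fun a => MvPolynomial.eval_C a] at h
  exact h

lemma eval_quadForm (f₂ f₁ f₀ : Polynomial ℝ) (x y z : ℝ) :
    MvPolynomial.eval ![x, y, z] (quadForm f₂ f₁ f₀)
      = f₂.eval x * y ^ 2 + f₁.eval x * y * z + f₀.eval x * z ^ 2 := by
  simp [quadForm, eval_toMv]

@[simp] lemma linSubst_toMv (a b c e : ℝ) (p : Polynomial ℝ) :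
    linSubst a b c e (toMv p) = toMv p := by
  unfold toMv
  rw [← Polynomial.aeval_algHom_apply]
  simp [linSubst]

@[simp] lemma linSubst_X_one (a b c e : ℝ) :
    linSubst a b c e (.X 1) = .C a * .X 1 + .C b * .X 2 := by
  simp [linSubst]

@[simp] lemma linSubst_X_two (a b c e : ℝ) :
    linSubst a b c e (.X 2) = .C c * .X 1 + .C e * .X 2 := by
  simp [linSubst]

lemma linSubst_quadForm (a b c e : ℝ) (f₂ f₁ f₀ : Polynomial ℝ) :
    linSubst a b c e (quadForm f₂ f₁ f₀) = quadForm
      (.C (a ^ 2) * f₂ + .C (a * c) * f₁ + .C (c ^ 2) * f₀)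
      (.C (2 * a * b) * f₂ + .C (a * e + b * c) * f₁ + .C (2 * c * e) * f₀)
      (.C (b ^ 2) * f₂ + .C (b * e) * f₁ + .C (e ^ 2) * f₀) := by
  simp only [quadForm, toMv_add, toMv_mul, toMv_C]
  simp only [map_add, map_mul, map_pow, linSubst_toMv, linSubst_X_one, linSubst_X_two, map_ofNat]
  ring

lemma eval_linSubst (a b c e x y z : ℝ) (f : MvPolynomial (Fin 3) ℝ) :
    MvPolynomial.eval ![x, y, z] (linSubst a b c e f)
      = MvPolynomial.eval ![x, a * y + b * z, c * y + e * z] f := by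
  have h : ((MvPolynomial.aeval ![x, y, z]).comp (linSubst a b c e) :
      MvPolynomial (Fin 3) ℝ →ₐ[ℝ] ℝ)
      = MvPolynomial.aeval ![x, a * y + b * z, c * y + e * z] := by
    ext i
    fin_cases i <;> simp [linSubst]
  exact DFunLike.congr_fun h f

lemma inS_linear {a b c e x y z : ℝ} (hdet : a * e - b * c ≠ 0) (h : inS x y z) :
    inS x (a * y + b * z) (c * y + e * z) := by
  refine ⟨h.1, fun h0 => h.2 ?_⟩
  obtain ⟨h1, h2⟩ := Prod.mk.inj h0
  have hy : (a * e - b * c) * y = 0 := by linear_combination e * h1 - b * h2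
  have hz : (a * e - b * c) * z = 0 := by linear_combination a * h2 - c * h1
  simp_all

lemma natDegree_linearCombination_le {d : ℕ} {f g h : Polynomial ℝ} (a b c : ℝ)
    (hf : f.natDegree ≤ d) (hg : g.natDegree ≤ d) (hh : h.natDegree ≤ d) :
    (.C a * f + .C b * g + .C c * h : Polynomial ℝ).natDegree ≤ d :=
  Polynomial.natDegree_add_le_of_degree_le
    (Polynomial.natDegree_add_le_of_degree_le
      ((Polynomial.natDegree_C_mul_le _ _).trans hf)
      ((Polynomial.natDegree_C_mul_le _ _).trans hg))
    ((Polynomial.natDegree_C_mul_le _ _).trans hh)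

lemma linSubst_mem_coneC {d : ℕ} {a b c e : ℝ} (hdet : a * e - b * c ≠ 0)
    {f : MvPolynomial (Fin 3) ℝ} (hf : f ∈ coneC d d) : linSubst a b c e f ∈ coneC d d := by
  obtain ⟨⟨f₂, f₁, f₀, rfl, h₂, h₁, h₀⟩, hpos⟩ := hf
  have hd : (d + d) / 2 = d := by omega
  rw [hd] at h₁
  refine ⟨⟨_, _, _, linSubst_quadForm .., natDegree_linearCombination_le _ _ _ h₂ h₁ h₀,
    hd.symm ▸ natDegree_linearCombination_le _ _ _ h₂ h₁ h₀,
    natDegree_linearCombination_le _ _ _ h₂ h₁ h₀⟩, fun x y z h => ?_⟩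
  rw [eval_linSubst]
  exact hpos _ _ _ (inS_linear hdet h)

lemma linSubst_linSubst (a b c e a' b' c' e' : ℝ) (f : MvPolynomial (Fin 3) ℝ) :
    linSubst a' b' c' e' (linSubst a b c e f)
      = linSubst (a * a' + b * c') (a * b' + b * e') (c * a' + e * c') (c * b' + e * e') f := by
  have h : (linSubst a' b' c' e').comp (linSubst a b c e)
      = linSubst (a * a' + b * c') (a * b' + b * e') (c * a' + e * c') (c * b' + e * e') := by
    apply MvPolynomial.algHom_ext
    intro i
    fin_cases i <;> simp [linSubst] <;> ring
  exact DFunLike.congr_fun h f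

lemma linSubst_one (f : MvPolynomial (Fin 3) ℝ) : linSubst 1 0 0 1 f = f := by
  have h : linSubst 1 0 0 1 = AlgHom.id ℝ _ := by
    apply MvPolynomial.algHom_ext
    intro i
    fin_cases i <;> simp [linSubst]
  exact DFunLike.congr_fun h f

/-- The substitution given by the inverse matrix undoes a linear substitution. -/
lemma linSubst_inverse {a b c e : ℝ} (hdet : a * e - b * c ≠ 0) (f : MvPolynomial (Fin 3) ℝ) :
    linSubst (e / (a * e - b * c)) (-b / (a * e - b * c)) (-c / (a * e - b * c))
      (a / (a * e - b * c)) (linSubst a b c e f) = f := by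
  rw [linSubst_linSubst]
  convert linSubst_one f using 2
  congr 1 <;> first | ring1 | linear_combination mul_inv_cancel₀ hdet

lemma inverse_linSubst {a b c e : ℝ} (hdet : a * e - b * c ≠ 0) (f : MvPolynomial (Fin 3) ℝ) :
    linSubst a b c e (linSubst (e / (a * e - b * c)) (-b / (a * e - b * c)) (-c / (a * e - b * c))
      (a / (a * e - b * c)) f) = f := by
  rw [linSubst_linSubst]
  convert linSubst_one f using 2
  congr 1 <;> first | ring1 | linear_combination mul_inv_cancel₀ hdet

lemma genExtremeRay.linSubst {d : ℕ} {a b c e : ℝ} (hdet : a * e - b * c ≠ 0)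
    {f : MvPolynomial (Fin 3) ℝ} (hf : genExtremeRay d d f) :
    genExtremeRay d d (linSubst a b c e f) := by
  obtain ⟨hne, hmem, hext⟩ := hf
  have hdet' : e / (a * e - b * c) * (a / (a * e - b * c))
      - -b / (a * e - b * c) * (-c / (a * e - b * c)) ≠ 0 := by
    have : e / (a * e - b * c) * (a / (a * e - b * c))
      - -b / (a * e - b * c) * (-c / (a * e - b * c)) = 1 / (a * e - b * c) := by
        field_simp
    rw [this]
    exact one_div_ne_zero hdet
  refine ⟨fun h0 => hne ?_, linSubst_mem_coneC hdet hmem, fun g h hg hh hgh => ?_⟩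
  · rw [← linSubst_inverse hdet f, h0, map_zero]
  · obtain ⟨⟨s, hs, hgs⟩, t, ht, hht⟩ := hext _ _ (linSubst_mem_coneC hdet' hg)
      (linSubst_mem_coneC hdet' hh) (by rw [← map_add, hgh, linSubst_inverse hdet])
    refine ⟨⟨s, hs, ?_⟩, t, ht, ?_⟩
    · rw [← map_smul, ← hgs, inverse_linSubst hdet]
    · rw [← map_smul, ← hht, inverse_linSubst hdet]

lemma eval_quadForm_div_eq_zero {f₂ f₁ f₀ : Polynomial ℝ} {x y z : ℝ} (hz : z ≠ 0)
    (h : MvPolynomial.eval ![x, y, z] (quadForm f₂ f₁ f₀) = 0) :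
    MvPolynomial.eval ![x, y / z, 1] (quadForm f₂ f₁ f₀) = 0 := by
  rw [eval_quadForm] at h ⊢
  field_simp
  linear_combination h

lemma isCoprime_sub_linearCombination {β₀ β₁ : ℝ} (hβ : β₀ ≠ β₁) {p q : Polynomial ℝ}
    (h : IsCoprime p q) : IsCoprime (p - q) (-(.C β₁) * p + .C β₀ * q) := by
  obtain ⟨u, v, huv⟩ := h
  have hinv : (.C (1 / (β₀ - β₁)) * (.C β₀ - .C β₁) : Polynomial ℝ) = 1 := by
    rw [← Polynomial.C_sub, ← Polynomial.C_mul, one_div_mul_cancel (sub_ne_zero.mpr hβ),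
      Polynomial.C_1]
  exact ⟨.C (1 / (β₀ - β₁)) * (u * .C β₀ + v * .C β₁), .C (1 / (β₀ - β₁)) * (u + v), by
    linear_combination (u * p + v * q) * hinv + huv⟩

theorem stmt_9 (d : ℕ) (f₂ f₁ f₀ h₂ h₁ h₀ : Polynomial ℝ) (β₀ β₁ : ℝ) (hβ : β₀ ≠ β₁)
    (hf : quadForm f₂ f₁ f₀ ∈ coneC d d)
    (hh : MvPolynomial.aeval
        (![MvPolynomial.X 0,
           MvPolynomial.C β₀ * MvPolynomial.X 1 + MvPolynomial.C β₁ * MvPolynomial.X 2,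
           MvPolynomial.X 1 + MvPolynomial.X 2] : Fin 3 → MvPolynomial (Fin 3) ℝ)
        (quadForm f₂ f₁ f₀) = quadForm h₂ h₁ h₀) :
    quadForm h₂ h₁ h₀ ∈ coneC d d ∧
    (genExtremeRay d d (quadForm f₂ f₁ f₀) → genExtremeRay d d (quadForm h₂ h₁ h₀)) ∧
    (∀ x₀ y₀ z₀ x₁ y₁ z₁ : ℝ, inS x₀ y₀ z₀ → inS x₁ y₁ z₁ →
      z₀ ≠ 0 → z₁ ≠ 0 → y₀ / z₀ ≠ y₁ / z₁ →
      MvPolynomial.eval ![x₀, y₀, z₀] (quadForm f₂ f₁ f₀) = 0 →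
      MvPolynomial.eval ![x₁, y₁, z₁] (quadForm f₂ f₁ f₀) = 0 →
      β₀ = y₀ / z₀ → β₁ = y₁ / z₁ →
      h₂.eval x₀ = 0 ∧ h₀.eval x₁ = 0) ∧
    (∀ r p q : Polynomial ℝ, ¬(p = 0 ∧ q = 0) → IsCoprime p q →
      quadForm h₂ h₁ h₀
        = toMv r * (toMv p * MvPolynomial.X 1 + toMv q * MvPolynomial.X 2) ^ 2 →
      quadForm f₂ f₁ f₀
          = MvPolynomial.C (1 / (β₀ - β₁) ^ 2)
              * (toMv r * (toMv (p - q) * MvPolynomial.X 1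
                  + toMv (-(Polynomial.C β₁) * p + Polynomial.C β₀ * q)
                      * MvPolynomial.X 2) ^ 2) ∧
        ¬(p - q = 0 ∧ -(Polynomial.C β₁) * p + Polynomial.C β₀ * q = 0) ∧
        IsCoprime (p - q) (-(Polynomial.C β₁) * p + Polynomial.C β₀ * q)) := by
  have hdet : β₀ * 1 - β₁ * 1 ≠ 0 := by simpa using sub_ne_zero.mpr hβ
  replace hh : linSubst β₀ β₁ 1 1 (quadForm f₂ f₁ f₀) = quadForm h₂ h₁ h₀ := by
    simpa [linSubst] using hh
  refine ⟨hh ▸ linSubst_mem_coneC hdet hf, fun h => hh ▸ h.linSubst hdet, ?_, ?_⟩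
  · rintro x₀ y₀ z₀ x₁ y₁ z₁ - - hz₀ hz₁ - hf₀ hf₁ rfl rfl
    have e₀ := congrArg (MvPolynomial.eval ![x₀, 1, 0]) hh
    have e₁ := congrArg (MvPolynomial.eval ![x₁, 0, 1]) hh
    rw [eval_linSubst, eval_quadForm h₂] at e₀ e₁
    simp only [mul_one, mul_zero, add_zero, zero_add, eval_quadForm_div_eq_zero hz₀ hf₀,
      eval_quadForm_div_eq_zero hz₁ hf₁] at e₀ e₁
    constructor <;> linarith
  · intro r p q _ hpq hr
    have hco := isCoprime_sub_linearCombination hβ hpq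
    refine ⟨?_, fun h => not_isCoprime_zero_zero (h.1 ▸ h.2 ▸ hco), hco⟩
    rw [← linSubst_inverse hdet (quadForm f₂ f₁ f₀), hh, hr]
    simp only [map_mul, map_add, map_pow, linSubst_toMv, linSubst_X_one, linSubst_X_two,
      toMv_sub, toMv_add, toMv_mul, toMv_neg, toMv_C, mul_one, div_eq_mul_inv, neg_mul, one_mul,
      map_neg, ← inv_pow]
    ring
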